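/- Let μ > 0, σ > −1, λ = (μ+σ+1)/2, and define F_σ φ(s) = μ ∫₀¹ (1−t)^σ ₂F₁(λ,λ;μ;st) φ(t) t^{μ−1} dt on L¹_μ(0,1). Then F_σ is bounded on L¹_μ(0,1) if and only if σ > 0, and in that case its operator norm equals (Γ(μ+1)/Γ(λ)²) Γ(σ). -/

import Mathlib

open MeasureTheory Real Set ENNReal

/-- The real Gauss hypergeometric function `₂F₁(a, b; c; x)`, defined by its power
series. -/
noncomputable def hyp2F1 (a b c x : ℝ) : ℝ :=
  ∑' k : ℕ, ((ascPochhammer ℝ k).eval a * (ascPochhammer ℝ k).eval b /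
    ((ascPochhammer ℝ k).eval c * (k.factorial : ℝ))) * x ^ k

/-- The weighted measure `dμ(t) = μ t^(μ-1) dt` on `(0, 1)`, so that
`L^p_μ(0,1) = L^p` of this measure. -/
noncomputable def wMeasure (μ : ℝ) : Measure ℝ :=
  (volume.restrict (Ioo (0:ℝ) 1)).withDensity fun t => ENNReal.ofReal (μ * t ^ (μ - 1))

/-- The integral operator `F_σ φ(s) = μ ∫₀¹ (1-t)^σ ₂F₁(λ,λ;μ;st) φ(t) t^(μ-1) dt`,
acting on non-negative functions (which determines its norm on `L^p_μ(0,1)`, the kernel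
being non-negative). -/
noncomputable def Fop (μ σ lam : ℝ) (f : ℝ → ℝ≥0∞) (s : ℝ) : ℝ≥0∞ :=
  ∫⁻ t, ENNReal.ofReal ((1 - t) ^ σ * hyp2F1 lam lam μ (s * t)) * f t ∂(wMeasure μ)

open Filter Topology

/-- The `k`-th Taylor coefficient of `₂F₁(a, b; c; ·)`. -/
noncomputable def hypCoeff (a b c : ℝ) (k : ℕ) : ℝ :=
  (ascPochhammer ℝ k).eval a * (ascPochhammer ℝ k).eval b /
    ((ascPochhammer ℝ k).eval c * (k.factorial : ℝ))

lemma hyp2F1_eq_tsum (a b c x : ℝ) : hyp2F1 a b c x = ∑' k, hypCoeff a b c k * x ^ k := rfl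

lemma hypCoeff_pos {a b c : ℝ} (ha : 0 < a) (hb : 0 < b) (hc : 0 < c) (k : ℕ) :
    0 < hypCoeff a b c k := by
  have := ascPochhammer_pos k a ha
  have := ascPochhammer_pos k b hb
  have := ascPochhammer_pos k c hc
  unfold hypCoeff
  positivity

lemma hypCoeff_zero (a b c : ℝ) : hypCoeff a b c 0 = 1 := by
  simp [hypCoeff]

lemma hypCoeff_succ (a b c : ℝ) (k : ℕ) :
    hypCoeff a b c (k + 1) =
      hypCoeff a b c k * ((a + k) / (c + k) * ((b + k) / (1 + k))) := by
  simp only [hypCoeff, ascPochhammer_succ_eval, Nat.factorial_succ]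
  push_cast
  rw [div_mul_div_comm, div_mul_div_comm]
  congr 1 <;> ring

/-- Raising the lower parameter by one divides the coefficients by `(c + k) / c`. -/
lemma hypCoeff_add_one_right {a b c : ℝ} (hc : 0 < c) (k : ℕ) :
    hypCoeff a b (c + 1) k = hypCoeff a b c k * (c / (c + k)) := by
  have h : c * (ascPochhammer ℝ k).eval (c + 1) = (ascPochhammer ℝ k).eval c * (c + k) := by
    rw [← ascPochhammer_succ_eval, ascPochhammer_succ_left]
    simp
  have h1 := ascPochhammer_pos k c hc
  have h2 := ascPochhammer_pos k (c + 1) (by positivity)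
  have h3 : 0 < c + k := by positivity
  unfold hypCoeff
  field_simp
  linear_combination -((ascPochhammer ℝ k).eval a * (ascPochhammer ℝ k).eval b) * h

lemma summable_hypCoeff_mul_pow {a b c x : ℝ} (ha : 0 < a) (hb : 0 < b) (hc : 0 < c)
    (hx0 : 0 ≤ x) (hx1 : x < 1) : Summable fun k => hypCoeff a b c k * x ^ k := by
  suffices H : ∀ y : ℝ, 0 < y → y < 1 → Summable fun k => hypCoeff a b c k * y ^ k by
    refine (H ((x + 1) / 2) (by linarith) (by linarith)).of_nonneg_of_le (fun k => ?_) fun k => ?_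
    · exact mul_nonneg (hypCoeff_pos ha hb hc k).le (by positivity)
    · have := (hypCoeff_pos ha hb hc k).le
      gcongr
      linarith
  intro y hy0 hy1
  have hlim (u v : ℝ) : Tendsto (fun k : ℕ => (u + k) / (v + k)) atTop (𝓝 1) := by
    simpa using tendsto_add_mul_div_add_mul_atTop_nhds u v 1 one_ne_zero
  refine summable_of_ratio_test_tendsto_lt_one hy1 (Eventually.of_forall fun k => ?_) ?_
  · exact (mul_pos (hypCoeff_pos ha hb hc k) (by positivity)).ne'
  · have := ((hlim a c).mul (hlim b 1)).mul_const y
    rw [one_mul, one_mul] at this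
    refine this.congr fun k => ?_
    have hk := hypCoeff_pos ha hb hc k
    rw [Real.norm_of_nonneg (mul_pos (hypCoeff_pos ha hb hc _) (by positivity)).le,
      Real.norm_of_nonneg (mul_pos (hypCoeff_pos ha hb hc _) (by positivity)).le, hypCoeff_succ, pow_succ]
    field_simp

/-- The binomial series `∑ (σ)ₖ / k! xᵏ = (1 - x) ^ (-σ)`. -/
lemma hasSum_ascPochhammer_div_factorial (σ : ℝ) {x : ℝ} (hx0 : 0 ≤ x) (hx1 : x < 1) :
    HasSum (fun k : ℕ => (ascPochhammer ℝ k).eval σ / k.factorial * x ^ k)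
      ((1 - x) ^ (-σ)) := by
  have h := (Real.one_div_one_sub_rpow_hasFPowerSeriesOnBall_zero σ).hasSum (y := x) (by
    simp [enorm_eq_nnnorm, ← NNReal.coe_lt_coe, abs_of_nonneg hx0, hx1])
  rw [Real.rpow_neg (by linarith)]
  simp only [zero_add, one_div] at h
  refine h.congr_fun fun k => ?_
  rw [FormalMultilinearSeries.ofScalars_apply_eq, ← Ring.multichoose_eq, smul_eq_mul]
  congr 1
  have := Ring.factorial_nsmul_multichoose_eq_ascPochhammer σ k
  rw [Polynomial.ascPochhammer_smeval_eq_eval, nsmul_eq_mul] at this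
  rw [← this]
  field_simp

/-- The ratio of the coefficients of `₂F₁(a, a; b; ·)` to those of `(1 - ·) ^ (-c)`. -/
noncomputable def pochRatio (a b c : ℝ) (k : ℕ) : ℝ :=
  (ascPochhammer ℝ k).eval a ^ 2 / ((ascPochhammer ℝ k).eval b * (ascPochhammer ℝ k).eval c)

lemma hypCoeff_eq_pochRatio_mul {a b c : ℝ} (hc : 0 < c) (k : ℕ) :
    hypCoeff a a b k = pochRatio a b c k * ((ascPochhammer ℝ k).eval c / k.factorial) := by
  have := ascPochhammer_pos k c hc
  unfold hypCoeff pochRatio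
  field_simp

lemma monotone_pochRatio {a b c : ℝ} (hb : 0 < b) (hc : 0 < c) (h : 2 * a = b + c) :
    Monotone (pochRatio a b c) := by
  refine monotone_nat_of_le_succ fun k => ?_
  have h1 := ascPochhammer_pos k b hb
  have h2 := ascPochhammer_pos k c hc
  have h3 : 0 < (b + k) * (c + k) := by positivity
  have key : pochRatio a b c (k + 1) =
      pochRatio a b c k * ((a + k) ^ 2 / ((b + k) * (c + k))) := by
    simp only [pochRatio, ascPochhammer_succ_eval]
    rw [div_mul_div_comm]
    congr 1 <;> ring
  rw [key]
  refine le_mul_of_one_le_right (by unfold pochRatio; positivity) ?_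
  rw [one_le_div h3]
  obtain rfl : a = (b + c) / 2 := by linarith
  nlinarith [sq_nonneg (b - c)]

lemma tendsto_pochRatio {a b c : ℝ} (hb : 0 < b) (hc : 0 < c) (h : 2 * a = b + c) :
    Tendsto (pochRatio a b c) atTop (𝓝 (Real.Gamma b / Real.Gamma a ^ 2 * Real.Gamma c)) := by
  have ha : 0 < a := by linarith
  have hprod (s : ℝ) (n : ℕ) :
      (∏ j ∈ Finset.range n, (s + j)) = (ascPochhammer ℝ n).eval s := by
    induction n with
    | zero => simp
    | succ n ih => rw [Finset.prod_range_succ, ih, ascPochhammer_succ_eval]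
  rw [← tendsto_add_atTop_iff_nat 1]
  refine (((Real.GammaSeq_tendsto_Gamma b).div ((Real.GammaSeq_tendsto_Gamma a).pow 2)
    (pow_pos (Real.Gamma_pos_of_pos ha) 2).ne').mul
      (Real.GammaSeq_tendsto_Gamma c)).congr' ?_
  filter_upwards [eventually_gt_atTop 0] with n hn
  have hn' : (0 : ℝ) < n := by exact_mod_cast hn
  have hpow : ((n : ℝ) ^ a) ^ 2 = (n : ℝ) ^ b * (n : ℝ) ^ c := by
    rw [← Real.rpow_add hn', ← h, mul_comm, Real.rpow_mul hn'.le, Real.rpow_two]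
  have h1 := ascPochhammer_pos (n + 1) a ha
  have h2 := ascPochhammer_pos (n + 1) b hb
  have h3 := ascPochhammer_pos (n + 1) c hc
  have h4 := Real.rpow_pos_of_pos hn' a
  simp only [Pi.div_apply, Real.GammaSeq, hprod, pochRatio]
  field_simp
  rw [hpow]

lemma rpow_mul_hyp2F1_le {a b σ t : ℝ} (hb : 0 < b) (hσ : 0 < σ) (h : 2 * a = b + σ)
    (ht0 : 0 ≤ t) (ht1 : t < 1) :
    (1 - t) ^ σ * hyp2F1 a a b t ≤ Real.Gamma b / Real.Gamma a ^ 2 * Real.Gamma σ := by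
  have ha : 0 < a := by linarith
  have h1t : 0 < 1 - t := by linarith
  set M := Real.Gamma b / Real.Gamma a ^ 2 * Real.Gamma σ
  have hsum : hyp2F1 a a b t ≤ M * (1 - t) ^ (-σ) := by
    rw [hyp2F1_eq_tsum]
    refine hasSum_le (fun k => ?_) (summable_hypCoeff_mul_pow ha ha hb ht0 ht1).hasSum
      ((hasSum_ascPochhammer_div_factorial σ ht0 ht1).mul_left M)
    rw [hypCoeff_eq_pochRatio_mul hσ, mul_assoc]
    have := ascPochhammer_pos k σ hσ
    gcongr
    exact (monotone_pochRatio hb hσ h).ge_of_tendsto (tendsto_pochRatio hb hσ h) k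
  calc (1 - t) ^ σ * hyp2F1 a a b t ≤ (1 - t) ^ σ * (M * (1 - t) ^ (-σ)) := by gcongr
    _ = M := by
      rw [mul_left_comm, ← Real.rpow_add h1t]
      simp

lemma tendsto_one_sub_nhdsLT_one : Tendsto (fun t : ℝ => 1 - t) (𝓝[<] 1) (𝓝[>] 0) := by
  refine tendsto_nhdsWithin_iff.2 ⟨?_, ?_⟩
  · exact (Continuous.tendsto' (by fun_prop) _ _ (by simp)).mono_left nhdsWithin_le_nhds
  · filter_upwards [self_mem_nhdsWithin] with t ht
    simpa using ht

lemma tendsto_rpow_mul_hyp2F1 {a b σ : ℝ} (hb : 0 < b) (hσ : 0 < σ) (h : 2 * a = b + σ) :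
    Tendsto (fun t => (1 - t) ^ σ * hyp2F1 a a b t) (𝓝[<] 1)
      (𝓝 (Real.Gamma b / Real.Gamma a ^ 2 * Real.Gamma σ)) := by
  have ha : 0 < a := by linarith
  have hIoo : Ioo (0 : ℝ) 1 ∈ 𝓝[<] (1 : ℝ) := Ioo_mem_nhdsLT one_pos
  refine tendsto_order.2 ⟨fun c hc => ?_, fun c hc => ?_⟩
  · obtain ⟨c', hcc', hc'⟩ := exists_between hc
    obtain ⟨N, hN⟩ := eventually_atTop.1 ((tendsto_pochRatio hb hσ h).eventually_const_lt hc')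
    set β : ℕ → ℝ := fun k => (ascPochhammer ℝ k).eval σ / k.factorial
    have hβ (k : ℕ) : 0 < β k := div_pos (ascPochhammer_pos k σ hσ) (by positivity)
    set K := ∑ k ∈ Finset.range N, |c'| * β k
    have hlow : Tendsto (fun t : ℝ => c' - K * (1 - t) ^ σ) (𝓝[<] 1) (𝓝 c') := by
      have h0 : Tendsto (fun x : ℝ => x ^ σ) (𝓝[>] 0) (𝓝 0) := by
        have := (Real.continuousAt_rpow_const 0 σ (Or.inr hσ.le)).tendsto
        rw [Real.zero_rpow hσ.ne'] at this
        exact this.mono_left nhdsWithin_le_nhds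
      simpa using ((h0.comp tendsto_one_sub_nhdsLT_one).const_mul K).const_sub c'
    filter_upwards [hlow.eventually_const_lt hcc', hIoo] with t ht htI
    have h1t : 0 < 1 - t := by linarith [htI.2]
    refine ht.trans_le ?_
    have hsum : c' * (1 - t) ^ (-σ) - K ≤ hyp2F1 a a b t := by
      have hK : HasSum (fun k => if k ∈ Finset.range N then |c'| * β k else 0) K := by
        have := hasSum_sum_of_ne_finset_zero (L := .unconditional ℕ) (s := Finset.range N)
          (f := fun k => if k ∈ Finset.range N then |c'| * β k else 0) fun k hk => if_neg hk
        rwa [Finset.sum_congr rfl fun k hk => if_pos hk] at this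
      rw [hyp2F1_eq_tsum]
      refine hasSum_le (fun k => ?_)
        (((hasSum_ascPochhammer_div_factorial σ htI.1.le htI.2).mul_left c').sub hK)
        (summable_hypCoeff_mul_pow ha ha hb htI.1.le htI.2).hasSum
      have ht0 := htI.1.le
      have hβk := hβ k
      change c' * (β k * t ^ k) - _ ≤ _
      split_ifs with hk
      · have h1 : c' * (β k * t ^ k) ≤ |c'| * β k := by
          have := pow_le_one₀ ht0 htI.2.le (n := k)
          gcongr
          · exact le_abs_self c'
          · exact mul_le_of_le_one_right hβk.le this
        have h2 : 0 ≤ hypCoeff a a b k * t ^ k :=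
          mul_nonneg (hypCoeff_pos ha ha hb k).le (by positivity)
        linarith
      · rw [sub_zero, hypCoeff_eq_pochRatio_mul hσ, mul_assoc]
        have := (hN k (by simpa using hk)).le
        change _ ≤ _ * (β k * t ^ k)
        gcongr
    calc c' - K * (1 - t) ^ σ = (1 - t) ^ σ * (c' * (1 - t) ^ (-σ) - K) := by
          have : (1 - t) ^ σ * (1 - t) ^ (-σ) = 1 := by rw [← Real.rpow_add h1t]; simp
          linear_combination (-c') * this
      _ ≤ _ := by gcongr
  · filter_upwards [hIoo] with t ht
    exact (rpow_mul_hyp2F1_le hb hσ h ht.1.le ht.2).trans_lt hc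

lemma sum_hypCoeff_mul_pow_le {a b c t : ℝ} (ha : 0 < a) (hb : 0 < b) (hc : 0 < c)
    (ht0 : 0 ≤ t) (ht1 : t < 1) (N : ℕ) :
    ∑ k ∈ Finset.range N, hypCoeff a b c k * t ^ k ≤ hyp2F1 a b c t :=
  (summable_hypCoeff_mul_pow ha hb hc ht0 ht1).sum_le_tsum _ fun k _ =>
    mul_nonneg (hypCoeff_pos ha hb hc k).le (by positivity)

lemma not_summable_hypCoeff {a : ℝ} (ha : 0 < a) :
    ¬ Summable (hypCoeff a a (2 * a)) := by
  have hbound (k : ℕ) : hypCoeff a a (2 * a) 1 ≤ (k + 1) * hypCoeff a a (2 * a) (k + 1) := by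
    induction k with
    | zero => simp
    | succ k ih =>
      have hpos := hypCoeff_pos ha ha (by positivity : 0 < 2 * a) (k + 1)
      refine ih.trans ?_
      rw [hypCoeff_succ a a (2 * a) (k + 1)]
      push_cast
      have h1 : (k : ℝ) + 1 ≤
          (a + (k + 1)) * (a + (k + 1)) / (2 * a + (k + 1)) := by
        rw [le_div_iff₀ (by positivity)]
        nlinarith [sq_nonneg a]
      calc ((k : ℝ) + 1) * hypCoeff a a (2 * a) (k + 1)
          ≤ (a + (k + 1)) * (a + (k + 1)) / (2 * a + (k + 1)) * hypCoeff a a (2 * a) (k + 1) := by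
            gcongr
        _ = _ := by
            field_simp
            ring
  intro hs
  have hc1 := hypCoeff_pos ha ha (by positivity : 0 < 2 * a) 1
  have hs' := ((summable_nat_add_iff 1).2 hs).mul_left (hypCoeff a a (2 * a) 1)⁻¹
  refine Real.not_summable_one_div_natCast ((summable_nat_add_iff 1).1
    (hs'.of_nonneg_of_le (fun k => by positivity) fun k => ?_))
  rw [div_le_iff₀ (by positivity), mul_assoc, le_inv_mul_iff₀ hc1]
  push_cast
  linarith [hbound k]

lemma tendsto_rpow_mul_hyp2F1_atTop {a b σ : ℝ} (ha : 0 < a) (hb : 0 < b) (hσ : σ ≤ 0)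
    (h : 2 * a = b + σ) :
    Tendsto (fun t => (1 - t) ^ σ * hyp2F1 a a b t) (𝓝[<] 1) atTop := by
  have hIoo : Ioo (0 : ℝ) 1 ∈ 𝓝[<] (1 : ℝ) := Ioo_mem_nhdsLT one_pos
  rcases hσ.lt_or_eq with hσ | rfl
  · refine tendsto_atTop_mono' _ ?_
      ((tendsto_rpow_neg_nhdsGT_zero hσ).comp tendsto_one_sub_nhdsLT_one)
    filter_upwards [hIoo] with t ht
    refine le_mul_of_one_le_right (Real.rpow_nonneg (by linarith [ht.2]) _) ?_
    simpa [hypCoeff_zero] using sum_hypCoeff_mul_pow_le ha ha hb ht.1.le ht.2 1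
  · obtain rfl : b = 2 * a := by linarith
    refine tendsto_atTop.2 fun B => ?_
    obtain ⟨N, hN⟩ := (((not_summable_iff_tendsto_nat_atTop_of_nonneg fun k =>
      (hypCoeff_pos ha ha hb k).le).1 (not_summable_hypCoeff ha)).eventually_gt_atTop B).exists
    have hcont : Tendsto (fun t : ℝ => ∑ k ∈ Finset.range N, hypCoeff a a (2 * a) k * t ^ k)
        (𝓝[<] 1) (𝓝 (∑ k ∈ Finset.range N, hypCoeff a a (2 * a) k)) :=
      (Continuous.tendsto' (by fun_prop) _ _ (by simp)).mono_left nhdsWithin_le_nhds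
    filter_upwards [hcont.eventually_const_lt hN, hIoo] with t ht htI
    rw [Real.rpow_zero, one_mul]
    exact ht.le.trans (sum_hypCoeff_mul_pow_le ha ha hb htI.1.le htI.2 N)

lemma measurable_hyp2F1 (a b c : ℝ) : Measurable (hyp2F1 a b c) :=
  Measurable.tsum (L := .unconditional ℕ) (f := fun k x => hypCoeff a b c k * x ^ k)
    fun k => by fun_prop

lemma measurable_wMeasure_density (μ : ℝ) :
    Measurable fun t : ℝ => ENNReal.ofReal (μ * t ^ (μ - 1)) := by
  fun_prop

instance sFinite_wMeasure (μ : ℝ) : SFinite (wMeasure μ) := by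
  unfold wMeasure
  infer_instance

lemma ae_wMeasure_mem_Ioo (μ : ℝ) : ∀ᵐ t ∂(wMeasure μ), t ∈ Ioo (0 : ℝ) 1 :=
  (withDensity_absolutelyContinuous _ _).ae_le (ae_restrict_mem measurableSet_Ioo)

lemma lintegral_pow_wMeasure {μ : ℝ} (hμ : 0 < μ) (k : ℕ) :
    ∫⁻ s, ENNReal.ofReal (s ^ k) ∂(wMeasure μ) = ENNReal.ofReal (μ / (μ + k)) := by
  have hr : -1 < μ - 1 + k := by
    have : (0 : ℝ) ≤ k := k.cast_nonneg
    linarith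
  rw [wMeasure, lintegral_withDensity_eq_lintegral_mul _ (measurable_wMeasure_density μ)
    (by fun_prop)]
  have hint : IntegrableOn (fun s : ℝ => μ * s ^ (μ - 1 + k)) (Ioo 0 1) :=
    (((intervalIntegrable_iff_integrableOn_Ioo_of_le zero_le_one).1
      (intervalIntegral.intervalIntegrable_rpow' hr)).const_mul μ)
  have hval : ∫ s in Ioo (0 : ℝ) 1, μ * s ^ (μ - 1 + k) = μ / (μ + k) := by
    rw [← integral_Ioc_eq_integral_Ioo, ← intervalIntegral.integral_of_le zero_le_one,
      intervalIntegral.integral_const_mul, integral_rpow (Or.inl hr), Real.one_rpow,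
      Real.zero_rpow (by linarith), show μ - 1 + k + 1 = μ + k by ring]
    ring
  rw [← hval, ofReal_integral_eq_lintegral_ofReal hint ?_]
  · refine setLIntegral_congr_fun measurableSet_Ioo fun s hs => ?_
    have := Real.rpow_nonneg hs.1.le (μ - 1)
    simp only [Pi.mul_apply]
    rw [← ENNReal.ofReal_mul (by positivity), Real.rpow_add hs.1, Real.rpow_natCast, mul_assoc]
  · filter_upwards [ae_restrict_mem measurableSet_Ioo] with s hs
    have := Real.rpow_nonneg hs.1.le (μ - 1 + k)
    simp only [Pi.zero_apply]
    positivity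

lemma wMeasure_ne_top {μ : ℝ} (hμ : 0 < μ) (A : Set ℝ) : wMeasure μ A ≠ ⊤ := by
  refine measure_ne_top_of_subset (subset_univ A) ?_
  have := lintegral_pow_wMeasure hμ 0
  simp only [pow_zero, ENNReal.ofReal_one, lintegral_one] at this
  rw [this]
  exact ENNReal.ofReal_ne_top

lemma wMeasure_Ioo_ne_zero {μ l : ℝ} (hμ : 0 < μ) (hl0 : 0 ≤ l) (hl1 : l < 1) :
    wMeasure μ (Ioo l 1) ≠ 0 := by
  have hsub : Ioo l 1 ⊆ Ioo (0 : ℝ) 1 := Ioo_subset_Ioo_left hl0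
  rw [wMeasure, withDensity_apply _ measurableSet_Ioo, Measure.restrict_restrict measurableSet_Ioo,
    inter_eq_left.2 hsub, ← pos_iff_ne_zero,
    setLIntegral_pos_iff (measurable_wMeasure_density μ)]
  refine lt_of_lt_of_le (b := volume (Ioo l 1)) (by simpa using hl1) (measure_mono fun t ht => ?_)
  refine ⟨?_, ht⟩
  have := Real.rpow_pos_of_pos (hsub ht).1 (μ - 1)
  simp only [Function.mem_support]
  exact (ENNReal.ofReal_pos.2 (by positivity)).ne'

/-- Integrating the hypergeometric kernel in `s` raises the lower parameter by one. -/
lemma lintegral_kernel_wMeasure {μ a b t : ℝ} (σ : ℝ) (hμ : 0 < μ) (ha : 0 < a) (hb : 0 < b)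
    (ht : t ∈ Ioo (0 : ℝ) 1) :
    ∫⁻ s, ENNReal.ofReal ((1 - t) ^ σ * hyp2F1 a b μ (s * t)) ∂(wMeasure μ) =
      ENNReal.ofReal ((1 - t) ^ σ * hyp2F1 a b (μ + 1) t) := by
  have h1t : 0 ≤ (1 - t) ^ σ := Real.rpow_nonneg (by linarith [ht.2]) _
  simp_rw [ENNReal.ofReal_mul h1t]
  rw [lintegral_const_mul _ (by have := measurable_hyp2F1 a b μ; fun_prop)]
  congr 1
  have hexp {c x : ℝ} (hc : 0 < c) (hx0 : 0 ≤ x) (hx1 : x < 1) :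
      ENNReal.ofReal (hyp2F1 a b c x) = ∑' k, ENNReal.ofReal (hypCoeff a b c k * x ^ k) :=
    ENNReal.ofReal_tsum_of_nonneg
      (fun k => mul_nonneg (hypCoeff_pos ha hb hc k).le (by positivity))
      (summable_hypCoeff_mul_pow ha hb hc hx0 hx1)
  have hcongr : ∀ᵐ s ∂(wMeasure μ), ENNReal.ofReal (hyp2F1 a b μ (s * t)) =
      ∑' k, ENNReal.ofReal (hypCoeff a b μ k * t ^ k) * ENNReal.ofReal (s ^ k) := by
    filter_upwards [ae_wMeasure_mem_Ioo μ] with s hs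
    rw [hexp hμ (mul_nonneg hs.1.le ht.1.le) (by nlinarith [hs.1, hs.2, ht.1, ht.2])]
    refine tsum_congr fun k => ?_
    have := hypCoeff_pos ha hb hμ k
    have := ht.1
    rw [← ENNReal.ofReal_mul (by positivity)]
    congr 1
    ring
  rw [lintegral_congr_ae hcongr, lintegral_tsum fun k => by fun_prop,
    hexp (by positivity) ht.1.le ht.2]
  refine tsum_congr fun k => ?_
  have := hypCoeff_pos ha hb hμ k
  have := ht.1
  rw [lintegral_const_mul _ (by fun_prop), lintegral_pow_wMeasure hμ,
    ← ENNReal.ofReal_mul (by positivity), hypCoeff_add_one_right hμ]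
  congr 1
  ring

lemma lintegral_Fop {μ a : ℝ} (σ : ℝ) (hμ : 0 < μ) (ha : 0 < a) {f : ℝ → ℝ≥0∞}
    (hf : Measurable f) :
    ∫⁻ s, Fop μ σ a f s ∂(wMeasure μ) =
      ∫⁻ t, ENNReal.ofReal ((1 - t) ^ σ * hyp2F1 a a (μ + 1) t) * f t ∂(wMeasure μ) := by
  have hF := measurable_hyp2F1 a a μ
  unfold Fop
  rw [lintegral_lintegral_swap (by unfold Function.uncurry; fun_prop)]
  refine lintegral_congr_ae ?_
  filter_upwards [ae_wMeasure_mem_Ioo μ] with t ht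
  rw [lintegral_mul_const _ (by fun_prop), lintegral_kernel_wMeasure σ hμ ha ha ht]

/-- A bound for multiplication by `g` on `L¹_μ` dominates the limit of `g` at `1`. -/
lemma limit_le_of_lintegral_mul_le {μ : ℝ} (hμ : 0 < μ) {g : ℝ → ℝ≥0∞} {C M : ℝ≥0∞}
    (hg : Tendsto g (𝓝[<] 1) (𝓝 M))
    (hC : ∀ f : ℝ → ℝ≥0∞, Measurable f →
      ∫⁻ t, g t * f t ∂(wMeasure μ) ≤ C * ∫⁻ t, f t ∂(wMeasure μ)) : M ≤ C := by
  refine le_of_forall_lt_imp_le_of_dense fun c hc => ?_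
  obtain ⟨l, hl, hlsub⟩ :=
    (mem_nhdsLT_iff_exists_mem_Ico_Ioo_subset one_pos).1 (hg.eventually_const_lt hc)
  have hA : MeasurableSet (Ioo l 1) := measurableSet_Ioo
  have h := hC ((Ioo l 1).indicator 1) (measurable_one.indicator hA)
  rw [lintegral_indicator_one hA] at h
  refine (ENNReal.mul_le_mul_iff_left (wMeasure_Ioo_ne_zero hμ hl.1 hl.2)
    (wMeasure_ne_top hμ _)).1 (le_trans ?_ h)
  rw [← lintegral_indicator_one hA, ← lintegral_const_mul _ (measurable_one.indicator hA)]
  refine lintegral_mono fun t => ?_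
  by_cases ht : t ∈ Ioo l 1
  · simpa [ht] using (hlsub ht).le
  · simp [ht]

/-- `F_σ` is bounded on `L¹_μ(0,1)` iff `σ > 0`, in which case its operator norm
equals `(Γ(μ+1)/Γ(λ)²) Γ(σ)`, where `λ = (μ+σ+1)/2`. -/
theorem Fop_l1_norm (μ σ lam : ℝ) (hμ : 0 < μ) (hσ : -1 < σ)
    (hlam : lam = (μ + σ + 1) / 2) :
    ((∃ C : ℝ≥0∞, C < ⊤ ∧ ∀ f : ℝ → ℝ≥0∞, Measurable f →
        ∫⁻ s, Fop μ σ lam f s ∂(wMeasure μ) ≤ C * ∫⁻ t, f t ∂(wMeasure μ)) ↔ 0 < σ) ∧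
    (0 < σ →
      sInf {C : ℝ≥0∞ | ∀ f : ℝ → ℝ≥0∞, Measurable f →
          ∫⁻ s, Fop μ σ lam f s ∂(wMeasure μ) ≤ C * ∫⁻ t, f t ∂(wMeasure μ)} =
        ENNReal.ofReal (Real.Gamma (μ + 1) / Real.Gamma lam ^ 2 * Real.Gamma σ)) := by
  have ha : 0 < lam := by linarith
  have hb : 0 < μ + 1 := by linarith
  have h2 : 2 * lam = (μ + 1) + σ := by linarith
  have hlower {C M : ℝ≥0∞}
      (hM : Tendsto (fun t => ENNReal.ofReal ((1 - t) ^ σ * hyp2F1 lam lam (μ + 1) t))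
        (𝓝[<] 1) (𝓝 M))
      (hC : ∀ f : ℝ → ℝ≥0∞, Measurable f →
        ∫⁻ s, Fop μ σ lam f s ∂(wMeasure μ) ≤ C * ∫⁻ t, f t ∂(wMeasure μ)) : M ≤ C :=
    limit_le_of_lintegral_mul_le hμ hM fun f hf => lintegral_Fop σ hμ ha hf ▸ hC f hf
  have hupper (hσ : 0 < σ) (f : ℝ → ℝ≥0∞) (hf : Measurable f) :
      ∫⁻ s, Fop μ σ lam f s ∂(wMeasure μ) ≤
        ENNReal.ofReal (Real.Gamma (μ + 1) / Real.Gamma lam ^ 2 * Real.Gamma σ) *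
          ∫⁻ t, f t ∂(wMeasure μ) := by
    rw [lintegral_Fop σ hμ ha hf, ← lintegral_const_mul _ hf]
    refine lintegral_mono_ae ?_
    filter_upwards [ae_wMeasure_mem_Ioo μ] with t ht
    exact mul_le_mul_left (ENNReal.ofReal_le_ofReal
      (rpow_mul_hyp2F1_le hb hσ h2 ht.1.le ht.2)) _
  refine ⟨⟨fun ⟨C, hCtop, hC⟩ => ?_, fun hσ => ⟨_, ENNReal.ofReal_lt_top, hupper hσ⟩⟩,
    fun hσ => le_antisymm (sInf_le (hupper hσ)) (le_sInf fun C hC => ?_)⟩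
  · by_contra hσ
    have hM := ENNReal.tendsto_ofReal_atTop.comp
      (tendsto_rpow_mul_hyp2F1_atTop ha hb (not_lt.1 hσ) h2)
    exact (hlower hM hC).not_gt hCtop
  · exact hlower (ENNReal.tendsto_ofReal (tendsto_rpow_mul_hyp2F1 hb hσ h2)) hC
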